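/- Let u_1, …, u_r ∈ M_3 be hermitian and let F be a face of L(u) = 𝔼(𝓜_3) with 0 < dim(F) < dim(L(u)). Then F is the image of a three-dimensional Euclidean ball under an affine map (in particular dim(F) ∈ {1,2,3}), and for every relative boundary point w ∈ rb(F) the fiber 𝔼|_{𝓜_3}^{-1}(w) is a singleton. -/

import Mathlib

open Set Filter Topology Matrix
open scoped ComplexOrder

/-- The joint numerical range `W(u₁,u₂) ⊆ ℝ²` of two (hermitian) matrices. -/
def jointNR {d : ℕ} (u₁ u₂ : Matrix (Fin d) (Fin d) ℂ) : Set (ℝ × ℝ) :=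
  {p | ∃ x : Fin d → ℂ, star x ⬝ᵥ x = 1 ∧
    p = ((star x ⬝ᵥ u₁.mulVec x).re, (star x ⬝ᵥ u₂.mulVec x).re)}

/-- The state space `𝓜_d`: positive semidefinite matrices of trace one. -/
def stateSpace (d : ℕ) : Set (Matrix (Fin d) (Fin d) ℂ) :=
  {ρ | ρ.PosSemidef ∧ ρ.trace = 1}

/-- The expected value map `ρ ↦ (tr(u₁ρ), tr(u₂ρ))` (real for hermitian arguments). -/
noncomputable def expVal2 {d : ℕ} (u₁ u₂ : Matrix (Fin d) (Fin d) ℂ)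
    (ρ : Matrix (Fin d) (Fin d) ℂ) : ℝ × ℝ :=
  ((u₁ * ρ).trace.re, (u₂ * ρ).trace.re)

/-- `f` restricted to `K` (viewed as a map onto `L`, both with subspace topologies) is open at
`v ∈ K` if the image of every neighborhood of `v` in `K` is a neighborhood of `f v` in `L`. -/
def MapsOpenAt {X Y : Type*} [TopologicalSpace X] [TopologicalSpace Y]
    (f : X → Y) (K : Set X) (L : Set Y) (v : X) : Prop :=
  ∀ N : Set X, N ⊆ K → N ∈ nhdsWithin v K → f '' N ∈ nhdsWithin (f v) L

/-- A supporting line of `C` at `p`: the level set of a nonzero linear functional attaining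
its maximum over `C` at `p`. -/
def IsSupportingLineAt (C : Set (ℝ × ℝ)) (p : ℝ × ℝ) (l : Set (ℝ × ℝ)) : Prop :=
  ∃ (φ : (ℝ × ℝ) →ₗ[ℝ] ℝ) (c : ℝ), φ ≠ 0 ∧ l = {q | φ q = c} ∧ φ p = c ∧ ∀ q ∈ C, φ q ≤ c

/-- A corner point of `C`: a point of `C` lying on more than one supporting line. -/
def IsCornerPoint (C : Set (ℝ × ℝ)) (p : ℝ × ℝ) : Prop :=
  p ∈ C ∧ ∃ l₁ l₂ : Set (ℝ × ℝ), l₁ ≠ l₂ ∧ IsSupportingLineAt C p l₁ ∧ IsSupportingLineAt C p l₂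

/-- A round boundary point of `C`: a boundary point which is neither a corner point nor lies
in the relative interior of a flat boundary portion (a nondegenerate segment in the boundary). -/
def IsRoundBoundaryPoint (C : Set (ℝ × ℝ)) (p : ℝ × ℝ) : Prop :=
  p ∈ frontier C ∧ ¬ IsCornerPoint C p ∧
    ¬ ∃ a b : ℝ × ℝ, a ≠ b ∧ segment ℝ a b ⊆ frontier C ∧ p ∈ openSegment ℝ a b

/-- `z` is singularly generated if all unit vectors generating it are proportional. -/
def SinglyGenerated {d : ℕ} (u₁ u₂ : Matrix (Fin d) (Fin d) ℂ) (z : ℝ × ℝ) : Prop :=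
  ∀ x y : Fin d → ℂ, star x ⬝ᵥ x = 1 → star y ⬝ᵥ y = 1 →
    ((star x ⬝ᵥ u₁.mulVec x).re, (star x ⬝ᵥ u₂.mulVec x).re) = z →
    ((star y ⬝ᵥ u₁.mulVec y).re, (star y ⬝ᵥ u₂.mulVec y).re) = z →
    ∃ c : ℂ, y = c • x

/-- `z` is multiply generated if it lies in the joint numerical range but is not
singularly generated. -/
def MultiplyGenerated {d : ℕ} (u₁ u₂ : Matrix (Fin d) (Fin d) ℂ) (z : ℝ × ℝ) : Prop :=
  z ∈ jointNR u₁ u₂ ∧ ¬ SinglyGenerated u₁ u₂ z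

/-- A matrix is unitarily reducible if it is unitarily equivalent to a block diagonal matrix
with (at least) two proper diagonal blocks. -/
def UnitarilyReducible {d : ℕ} (A : Matrix (Fin d) (Fin d) ℂ) : Prop :=
  ∃ (a b : ℕ) (hab : a + b = d), 0 < a ∧ 0 < b ∧
    ∃ U ∈ Matrix.unitaryGroup (Fin d) ℂ,
      ∃ (B : Matrix (Fin a) (Fin a) ℂ) (C : Matrix (Fin b) (Fin b) ℂ),
        star U * A * U =
          Matrix.reindex (finSumFinEquiv.trans (finCongr hab))
            (finSumFinEquiv.trans (finCongr hab)) (Matrix.fromBlocks B 0 0 C)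

/-- A simplex is the convex hull of finitely many affinely independent points. -/
def IsSimplex {Y : Type*} [AddCommGroup Y] [Module ℝ Y] (S : Set Y) : Prop :=
  ∃ s : Finset Y, AffineIndependent ℝ (fun p : (s : Set Y) => (p : Y)) ∧
    S = convexHull ℝ (s : Set Y)

/-- `w` is a simplicial point of `C` if finitely many simplices contained in `C`
cover a neighborhood of `w` in `C`. -/
def IsSimplicialPoint {Y : Type*} [AddCommGroup Y] [Module ℝ Y] [TopologicalSpace Y]
    (C : Set Y) (w : Y) : Prop :=
  ∃ (m : ℕ) (S : Fin m → Set Y),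
    (∀ i, IsSimplex (S i) ∧ S i ⊆ C) ∧ (⋃ i, S i) ∈ nhdsWithin w C

/-- A face of a convex set `C`: a convex subset `F ⊆ C` such that any segment of `C` whose
relative interior meets `F` lies in `F` (i.e. `F` is convex and extreme in `C`). -/
def IsFaceOf {Y : Type*} [AddCommGroup Y] [Module ℝ Y] (C F : Set Y) : Prop :=
  Convex ℝ F ∧ IsExtreme ℝ C F

/-- The dimension of a convex set: the dimension of its affine hull. -/
noncomputable def convDim {Y : Type*} [NormedAddCommGroup Y] [NormedSpace ℝ Y]
    (C : Set Y) : ℕ :=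
  Module.finrank ℝ (affineSpan ℝ C).direction

/-- The expected value map for `r` observables. -/
noncomputable def expVal {d r : ℕ} (u : Fin r → Matrix (Fin d) (Fin d) ℂ)
    (ρ : Matrix (Fin d) (Fin d) ℂ) : Fin r → ℝ :=
  fun i => ((u i) * ρ).trace.re

theorem smul_diagonal_diag_sub_posSemidef {n : Type*} [Fintype n] [DecidableEq n]
    {A : Matrix n n ℂ} (hA : A.PosSemidef) :
    ((Fintype.card n : ℂ) • diagonal A.diag - A).PosSemidef := by
  have hsum : ∑ i, Matrix.single i i (1 : ℂ) = (1 : Matrix n n ℂ) := Matrix.sum_single_one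
  have key : (Fintype.card n : ℂ) • diagonal A.diag - A =
      (2⁻¹ : ℂ) • ∑ i, ∑ j, (Matrix.single i i (1 : ℂ) - Matrix.single j j 1)ᴴ * A *
        (Matrix.single i i (1 : ℂ) - Matrix.single j j 1) := by
    have h1 : ∀ i j, (Matrix.single i i (1 : ℂ) - Matrix.single j j 1)ᴴ * A *
        (Matrix.single i i (1 : ℂ) - Matrix.single j j 1) =
        Matrix.single i i (A i i) + Matrix.single j j (A j j)
          - (Matrix.single i i 1 * A * Matrix.single j j 1)
          - (Matrix.single j j 1 * A * Matrix.single i i 1) := by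
      intro i j
      simp only [conjTranspose_sub, conjTranspose_single, star_one, sub_mul, mul_sub,
        single_mul_mul_single, one_mul, mul_one]
      abel
    have hA1 : ∑ i, ∑ j, (Matrix.single i i 1 * A * Matrix.single j j 1) = A := by
      simp_rw [← Finset.mul_sum, hsum, mul_one, ← Finset.sum_mul, hsum, one_mul]
    have hA2 : ∑ i, ∑ j, (Matrix.single j j 1 * A * Matrix.single i i 1) = A := by
      rw [Finset.sum_comm, hA1]
    have hd : ∑ i, Matrix.single i i (A i i) = diagonal A.diag := by
      ext a b
      simp [Matrix.sum_apply, Matrix.single_apply, Matrix.diagonal_apply, ite_and]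
    simp_rw [h1, Finset.sum_sub_distrib, Finset.sum_add_distrib, hA1, hA2, hd, Finset.sum_const,
      ← Finset.smul_sum, hd, Finset.card_univ]
    module
  rw [key]
  refine PosSemidef.smul (posSemidef_sum _ fun i _ => posSemidef_sum _ fun j _ =>
    hA.conjTranspose_mul_mul_same _) ?_
  positivity

theorem Matrix.PosSemidef.apply_eq_zero_of_diag_eq_zero {n : Type*} [Fintype n]
    {A : Matrix n n ℂ} (hA : A.PosSemidef) {k : n} (hk : A k k = 0) (j : n) :
    A k j = 0 ∧ A j k = 0 := by
  have h := (hA.submatrix ![k, j]).det_nonneg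
  have hs : A j k = star (A k j) := (hA.1.apply j k).symm
  simp only [det_fin_two, submatrix_apply, cons_val_zero, cons_val_one, hk, hs, zero_mul,
    zero_sub, RCLike.star_def, Complex.mul_conj] at h
  have h2 : Complex.normSq (A k j) ≤ 0 := by
    have : (0 : ℂ) ≤ ((-Complex.normSq (A k j) : ℝ) : ℂ) := by push_cast; exact h
    have := Complex.zero_le_real.mp this
    linarith
  have h3 : A k j = 0 := Complex.normSq_eq_zero.mp (le_antisymm h2 (Complex.normSq_nonneg _))
  simp [hs, h3]

theorem exists_diagonal_sub_smul_posSemidef {n : Type*} [Fintype n] [DecidableEq n]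
    {l : n → ℝ} (hl : ∀ i, 0 ≤ l i) {A : Matrix n n ℂ} (hA : A.PosSemidef)
    (h : ∀ i, l i = 0 → A i i = 0) :
    ∃ ε : ℝ, 0 < ε ∧ (diagonal (fun i => (l i : ℂ)) - ε • A).PosSemidef := by
  have hre : ∀ i, A i i = ((A i i).re : ℂ) := fun i => (hA.1.coe_re_apply_self i).symm
  have hev : ∀ᶠ ε : ℝ in 𝓝[>] 0, ∀ i, 0 ≤ l i - ε * (Fintype.card n * (A i i).re) := by
    rw [eventually_all]
    intro i
    rcases (hl i).eq_or_lt with h0 | h0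
    · simp [← h0, h i h0.symm]
    · refine nhdsWithin_le_nhds ?_
      have : Tendsto (fun ε : ℝ => l i - ε * (Fintype.card n * (A i i).re)) (𝓝 0) (𝓝 (l i)) := by
        have : Continuous (fun ε : ℝ => l i - ε * (Fintype.card n * (A i i).re)) := by fun_prop
        simpa using this.tendsto 0
      exact (this.eventually (lt_mem_nhds h0)).mono fun _ => le_of_lt
  obtain ⟨ε, hε, hpos⟩ := (hev.and self_mem_nhdsWithin).exists
  refine ⟨ε, hpos, ?_⟩
  have key : diagonal (fun i => (l i : ℂ)) - ε • A =
      diagonal (fun i => ((l i - ε * (Fintype.card n * (A i i).re) : ℝ) : ℂ)) +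
      (ε : ℝ) • ((Fintype.card n : ℂ) • diagonal A.diag - A) := by
    ext i j
    by_cases hij : i = j
    · subst hij
      simp only [Matrix.sub_apply, Matrix.add_apply, Matrix.smul_apply, diagonal_apply_eq, diag_apply, smul_eq_mul,
        Complex.real_smul]
      push_cast
      rw [← hre]
      ring
    · simp [hij]
  rw [key]
  refine PosSemidef.add (PosSemidef.diagonal fun i => ?_)
    ((smul_diagonal_diag_sub_posSemidef hA).smul (le_of_lt hpos))
  exact Complex.zero_le_real.mpr (hε i)

theorem Matrix.IsHermitian.exists_unitary_diagonalization {n : Type*} [Fintype n] [DecidableEq n]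
    {A : Matrix n n ℂ} (hA : A.IsHermitian) :
    ∃ U : Matrix n n ℂ, Uᴴ * U = 1 ∧ U * Uᴴ = 1 ∧
      Uᴴ * A * U = diagonal (fun i => (hA.eigenvalues i : ℂ)) := by
  refine ⟨hA.eigenvectorUnitary, ?_, ?_, ?_⟩
  · exact Unitary.coe_star_mul_self _
  · exact Unitary.coe_mul_star_self _
  · have := hA.conjStarAlgAut_star_eigenvectorUnitary
    rw [Unitary.conjStarAlgAut_apply] at this
    simpa [star_eq_conjTranspose, Function.comp_def] using this

theorem Matrix.PosDef.exists_sub_smul_posSemidef {n : Type*} [Fintype n] [DecidableEq n]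
    {P A : Matrix n n ℂ} (hP : P.PosDef) (hA : A.PosSemidef) :
    ∃ ε : ℝ, 0 < ε ∧ (P - ε • A).PosSemidef := by
  obtain ⟨U, -, hU2, hd⟩ := IsHermitian.exists_unitary_diagonalization hP.1
  obtain ⟨ε, hε, h⟩ := exists_diagonal_sub_smul_posSemidef (fun i => (hP.eigenvalues_pos i).le)
    (hA.conjTranspose_mul_mul_same U) fun i hi => absurd hi (hP.eigenvalues_pos i).ne'
  refine ⟨ε, hε, ?_⟩
  have h2 := h.mul_mul_conjTranspose_same U
  rw [← hd] at h2
  convert h2 using 1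
  have hc : ∀ X, U * (Uᴴ * X * U) * Uᴴ = X := fun X => by
    calc U * (Uᴴ * X * U) * Uᴴ = (U * Uᴴ) * X * (U * Uᴴ) := by simp only [mul_assoc]
      _ = X := by simp [hU2]
  rw [mul_sub, sub_mul, hc, Matrix.mul_smul, Matrix.smul_mul, hc]

theorem mem_of_isExtreme_stateSpace {d : ℕ} {G : Set (Matrix (Fin d) (Fin d) ℂ)}
    (hG : IsExtreme ℝ (stateSpace d) G) {P A : Matrix (Fin d) (Fin d) ℂ} (hP : P ∈ G)
    (hA : A ∈ stateSpace d) {ε : ℝ} (hε : 0 < ε) (h : (P - ε • A).PosSemidef) : A ∈ G := by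
  have hPS := hG.subset hP
  have h1 : 0 ≤ 1 - ε := by
    have := h.trace_nonneg
    rw [trace_sub, trace_smul, hA.2, hPS.2] at this
    have h2 : (0 : ℂ) ≤ ((1 - ε : ℝ) : ℂ) := by simpa using this
    exact Complex.zero_le_real.mp h2
  have hd : 0 < 1 - ε / 2 := by linarith
  refine hG.left_mem_of_mem_openSegment hA (y := (1 - ε / 2)⁻¹ • (P - (ε / 2) • A)) ⟨?_, ?_⟩ hP
    ⟨ε / 2, 1 - ε / 2, by positivity, hd, by ring, ?_⟩
  · refine PosSemidef.smul ?_ (inv_nonneg.mpr hd.le)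
    have : P - (ε / 2) • A = (1 / 2 : ℝ) • P + (1 / 2 : ℝ) • (P - ε • A) := by module
    rw [this]
    exact (hPS.1.smul (by norm_num : (0 : ℝ) ≤ 1 / 2)).add
      (h.smul (by norm_num : (0 : ℝ) ≤ 1 / 2))
  · rw [trace_smul, trace_sub, trace_smul, hA.2, hPS.2, Complex.real_smul, Complex.real_smul]
    have : (1 - (ε : ℂ) / 2) ≠ 0 := by exact_mod_cast hd.ne'
    push_cast
    rw [mul_one]
    exact inv_mul_cancel₀ this
  · rw [smul_smul, mul_inv_cancel₀ hd.ne']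
    module

theorem posDef_diagonal_add {n : Type*} [Fintype n] [DecidableEq n] {l : n → ℝ}
    (hl : ∀ i, 0 ≤ l i) {k : n} (hk : ∀ i, i ≠ k → l i ≠ 0) {A : Matrix n n ℂ}
    (hA : A.PosSemidef) (hAk : A k k ≠ 0) : (diagonal (fun i => (l i : ℂ)) + A).PosDef := by
  have hD : (diagonal (fun i => (l i : ℂ))).PosSemidef :=
    PosSemidef.diagonal fun i => Complex.zero_le_real.mpr (hl i)
  refine PosDef.of_dotProduct_mulVec_pos (hD.add hA).1 fun x hx => ?_
  have h1 := hD.dotProduct_mulVec_nonneg x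
  have h2 := hA.dotProduct_mulVec_nonneg x
  rw [add_mulVec, dotProduct_add]
  by_cases hxk : ∃ i, i ≠ k ∧ x i ≠ 0
  · obtain ⟨i, hik, hxi⟩ := hxk
    refine add_pos_of_pos_of_nonneg ?_ h2
    have : star x ⬝ᵥ (diagonal (fun i => (l i : ℂ)) *ᵥ x) =
        ((∑ i, l i * Complex.normSq (x i) : ℝ) : ℂ) := by
      simp only [dotProduct, mulVec_diagonal, Pi.star_apply, RCLike.star_def]
      push_cast
      refine Finset.sum_congr rfl fun i _ => ?_
      rw [← Complex.mul_conj]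
      ring
    rw [this]
    refine Complex.zero_lt_real.mpr (Finset.sum_pos' (fun i _ =>
      mul_nonneg (hl i) (Complex.normSq_nonneg _)) ⟨i, Finset.mem_univ _, ?_⟩)
    exact mul_pos ((hl i).lt_of_ne' (hk i hik)) (Complex.normSq_pos.mpr hxi)
  · push Not at hxk
    have hxs : x = Pi.single k (x k) := by
      ext i
      by_cases hik : i = k
      · subst hik; simp
      · simp [hik, hxk i hik]
    have hxk0 : x k ≠ 0 := fun h0 => hx (by rw [hxs, h0, Pi.single_zero])
    refine add_pos_of_nonneg_of_pos h1 (h2.lt_of_ne' ?_)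
    rw [hxs, Pi.star_single, single_dotProduct, mulVec_single]
    simp [hxk0, hAk]

theorem conj_mem_stateSpace {d e : ℕ} {V : Matrix (Fin d) (Fin e) ℂ} (hV : Vᴴ * V = 1)
    {A : Matrix (Fin e) (Fin e) ℂ} (hA : A ∈ stateSpace e) : V * A * Vᴴ ∈ stateSpace d :=
  ⟨hA.1.mul_mul_conjTranspose_same V, by
    rw [trace_mul_comm, ← Matrix.mul_assoc, hV, one_mul, hA.2]⟩

theorem eq_of_isExtreme_stateSpace_of_posDef {d : ℕ} {G : Set (Matrix (Fin d) (Fin d) ℂ)}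
    (hG : IsExtreme ℝ (stateSpace d) G) {P : Matrix (Fin d) (Fin d) ℂ} (hP : P ∈ G)
    (hPd : P.PosDef) : G = stateSpace d :=
  hG.subset.antisymm fun _ hA =>
    let ⟨_, hε, h⟩ := PosDef.exists_sub_smul_posSemidef hPd hA.1
    mem_of_isExtreme_stateSpace hG hP hA hε h

theorem eq_single_of_mem_stateSpace {d : ℕ} {A : Matrix (Fin d) (Fin d) ℂ}
    (hA : A ∈ stateSpace d) {l : Fin d} (h : ∀ i, i ≠ l → A i i = 0) :
    A = Matrix.single l l 1 := by
  have hl : A l l = 1 := by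
    have := hA.2
    rwa [trace, Finset.sum_eq_single l (fun i _ hi => by simpa using h i hi) (by simp)] at this
  ext a b
  by_cases ha : a = l
  · by_cases hb : b = l
    · subst ha hb; simpa using hl
    · rw [Matrix.single_apply_of_col_ne _ _ (Ne.symm hb)]
      exact (hA.1.apply_eq_zero_of_diag_eq_zero (h b hb) a).2
  · rw [Matrix.single_apply_of_row_ne (Ne.symm ha)]
    exact (hA.1.apply_eq_zero_of_diag_eq_zero (h a ha) b).1

theorem setOf_apply_eq_zero_eq_image_stateSpace {d : ℕ} (k : Fin (d + 1)) :
    {A ∈ stateSpace (d + 1) | A k k = 0} =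
      (fun B => (1 : Matrix (Fin (d + 1)) (Fin (d + 1)) ℂ).submatrix id k.succAbove * B *
        ((1 : Matrix (Fin (d + 1)) (Fin (d + 1)) ℂ).submatrix id k.succAbove)ᴴ) ''
        stateSpace d := by
  set W := (1 : Matrix (Fin (d + 1)) (Fin (d + 1)) ℂ).submatrix id k.succAbove
  have hW1 : Wᴴ * W = 1 := by
    ext i j
    simp [W, mul_apply, Matrix.one_apply, k.succAbove_right_injective.eq_iff]
  have hWk : ∀ i, W k i = 0 := fun i => by simp [W, (k.succAbove_ne i).symm]
  have hWs : ∀ i j, W (k.succAbove i) j = if i = j then 1 else 0 := fun i j => by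
    simp [W, Matrix.one_apply, k.succAbove_right_injective.eq_iff]
  ext A
  constructor
  · rintro ⟨hA, hk⟩
    refine ⟨A.submatrix k.succAbove k.succAbove, ⟨hA.1.submatrix _, ?_⟩, ?_⟩
    · rw [← hA.2, trace, trace, Fin.sum_univ_succAbove _ k]
      simp [hk]
    · ext a b
      have hz := hA.1.apply_eq_zero_of_diag_eq_zero hk
      cases a using k.succAboveCases <;> cases b using k.succAboveCases <;>
        simp [mul_apply, hWk, hWs, hz, apply_ite]
  · rintro ⟨B, hB, rfl⟩
    exact ⟨conj_mem_stateSpace hW1 hB, by simp [mul_apply, hWk]⟩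

/-- A proper nontrivial face of the state space of `M_3` is a congruence image of the state space of
`M_2`. -/
theorem exists_eq_conj_image_of_isExtreme_stateSpace {G : Set (Matrix (Fin 3) (Fin 3) ℂ)}
    (hconv : Convex ℝ G) (hG : IsExtreme ℝ (stateSpace 3) G) (hne : G ≠ stateSpace 3)
    (hnt : G.Nontrivial) :
    ∃ V : Matrix (Fin 3) (Fin 2) ℂ, G = (fun B => V * B * Vᴴ) '' stateSpace 2 := by
  have hno : ∀ P ∈ G, ¬ P.PosDef := fun P hP hPd =>
    hne (eq_of_isExtreme_stateSpace_of_posDef hG hP hPd)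
  have hmid : ∀ A ∈ G, ∀ B ∈ G, (2⁻¹ : ℝ) • (A + B) ∈ G := fun A hA B hB => by
    rw [smul_add]
    exact hconv hA hB (by norm_num) (by norm_num) (by norm_num)
  obtain ⟨ρ, hρ, σ, hσ, hρσ⟩ := hnt
  set m := (2⁻¹ : ℝ) • (ρ + σ) with hm
  have hmG : m ∈ G := hmid ρ hρ σ hσ
  have hmS := (hG.subset hmG).1
  obtain ⟨U, hU1, hU2, hd⟩ := IsHermitian.exists_unitary_diagonalization hmS.1
  have hl := hmS.eigenvalues_nonneg
  set l := hmS.1.eigenvalues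
  have hc : ∀ X, U * (Uᴴ * X * U) * Uᴴ = X := fun X => by
    calc U * (Uᴴ * X * U) * Uᴴ = (U * Uᴴ) * X * (U * Uᴴ) := by simp only [mul_assoc]
      _ = X := by simp [hU2]
  have hc' : ∀ X, Uᴴ * (U * X * Uᴴ) * U = X := fun X => by
    calc Uᴴ * (U * X * Uᴴ) * U = (Uᴴ * U) * X * (Uᴴ * U) := by simp only [mul_assoc]
      _ = X := by simp [hU1]
  have hS : ∀ X ∈ stateSpace 3, Uᴴ * X * U ∈ stateSpace 3 := fun X hX => by
    simpa using conj_mem_stateSpace (V := Uᴴ) (by simpa using hU2) hX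
  have hS' : ∀ X ∈ stateSpace 3, U * X * Uᴴ ∈ stateSpace 3 := fun X hX =>
    conj_mem_stateSpace hU1 hX
  obtain ⟨k, hk⟩ : ∃ k, l k = 0 := by
    by_contra! h
    exact hno m hmG (hmS.1.posDef_iff_eigenvalues_pos.mpr fun i => (hl i).lt_of_ne' (h i))
  have hdiag : ∀ i, l i = 0 → (Uᴴ * ρ * U) i i = 0 ∧ (Uᴴ * σ * U) i i = 0 := by
    intro i hi
    have h1 : (Uᴴ * m * U) i i = 0 := by rw [hd]; simp [hi]
    have h2 : (Uᴴ * ρ * U) i i + (Uᴴ * σ * U) i i = 0 := by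
      rw [hm, Matrix.mul_smul, Matrix.smul_mul, mul_add, add_mul, Matrix.smul_apply,
        smul_eq_zero] at h1
      simpa using h1
    have p1 := (hS ρ (hG.subset hρ)).1.diag_nonneg (i := i)
    have p2 := (hS σ (hG.subset hσ)).1.diag_nonneg (i := i)
    exact (add_eq_zero_iff_of_nonneg p1 p2).mp h2
  have huniq : ∀ j, j ≠ k → l j ≠ 0 := by
    intro j hjk hj
    obtain ⟨i, hi⟩ : ∃ i : Fin 3, ∀ a, a ≠ i → a = j ∨ a = k := by
      clear hj hdiag hk
      revert j k
      decide
    have hz : ∀ a, a ≠ i → l a = 0 := fun a ha => by rcases hi a ha with rfl | rfl <;> assumption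
    have e1 := eq_single_of_mem_stateSpace (hS ρ (hG.subset hρ)) fun a ha => (hdiag a (hz a ha)).1
    have e2 := eq_single_of_mem_stateSpace (hS σ (hG.subset hσ)) fun a ha => (hdiag a (hz a ha)).2
    exact hρσ (by rw [← hc ρ, ← hc σ, e1, e2])
  have hmem : ∀ A, A ∈ G ↔ A ∈ stateSpace 3 ∧ (Uᴴ * A * U) k k = 0 := by
    intro A
    constructor
    · refine fun hA => ⟨hG.subset hA, ?_⟩
      by_contra hne0
      have h1 := posDef_diagonal_add hl huniq (hS A (hG.subset hA)).1 hne0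
      rw [← hd, ← add_mul, ← mul_add] at h1
      have h2 := h1.mul_mul_conjTranspose_same (B := U)
        (vecMul_injective_of_isUnit (IsUnit.of_mul_eq_one _ hU2))
      rw [hc] at h2
      exact hno _ (hmid m hmG A hA) (h2.smul (by norm_num : (0 : ℝ) < 2⁻¹))
    · rintro ⟨hA, hAk⟩
      obtain ⟨ε, hε, h⟩ := exists_diagonal_sub_smul_posSemidef hl (hS A hA).1 fun i hi => by
        by_cases hik : i = k
        · rw [hik, hAk]
        · exact absurd hi (huniq i hik)
      refine mem_of_isExtreme_stateSpace hG hmG hA hε ?_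
      have h2 := h.mul_mul_conjTranspose_same U
      rwa [← hd, mul_sub, sub_mul, hc, Matrix.mul_smul, Matrix.smul_mul, hc] at h2
  have himg := setOf_apply_eq_zero_eq_image_stateSpace k
  set W := (1 : Matrix (Fin 3) (Fin 3) ℂ).submatrix id k.succAbove
  refine ⟨U * W, ?_⟩
  have hGimg : G = (fun B => U * B * Uᴴ) '' {A ∈ stateSpace 3 | A k k = 0} := by
    ext A
    rw [hmem]
    constructor
    · exact fun hA => ⟨Uᴴ * A * U, ⟨hS A hA.1, hA.2⟩, hc A⟩
    · rintro ⟨B, hB, rfl⟩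
      exact ⟨hS' B hB.1, by rw [hc']; exact hB.2⟩
  rw [hGimg, himg, image_image]
  simp only [conjTranspose_mul, Matrix.mul_assoc]

/-- The Bloch parametrization of hermitian `2 × 2` matrices of trace one. -/
noncomputable def blochMap : EuclideanSpace ℝ (Fin 3) →ᵃ[ℝ] Matrix (Fin 2) (Fin 2) ℂ where
  toFun x := (2⁻¹ : ℝ) • !![1 + (x 2 : ℂ), x 0 - x 1 * Complex.I; x 0 + x 1 * Complex.I, 1 - x 2]
  linear :=
    { toFun := fun x =>
        (2⁻¹ : ℝ) • !![(x 2 : ℂ), x 0 - x 1 * Complex.I; x 0 + x 1 * Complex.I, -x 2]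
      map_add' := fun x y => by
        ext i j
        fin_cases i <;> fin_cases j <;> simp <;> ring
      map_smul' := fun c x => by
        ext i j
        fin_cases i <;> fin_cases j <;> simp <;> ring }
  map_vadd' x y := by
    ext i j
    fin_cases i <;> fin_cases j <;> simp <;> ring

theorem blochMap_apply (x : EuclideanSpace ℝ (Fin 3)) : blochMap x =
    (2⁻¹ : ℝ) • !![1 + (x 2 : ℂ), x 0 - x 1 * Complex.I; x 0 + x 1 * Complex.I, 1 - x 2] := rfl

theorem det_blochMap (x : EuclideanSpace ℝ (Fin 3)) :
    (blochMap x).det = ((4⁻¹ * (1 - ‖x‖ ^ 2) : ℝ) : ℂ) := by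
  rw [EuclideanSpace.norm_sq_eq, Fin.sum_univ_three, blochMap_apply, det_fin_two]
  simp
  linear_combination (x 1 : ℂ) ^ 2 / 4 * Complex.I_sq

theorem trace_blochMap (x : EuclideanSpace ℝ (Fin 3)) : (blochMap x).trace = 1 := by
  rw [blochMap_apply, trace_fin_two]
  simp
  ring

theorem isHermitian_blochMap (x : EuclideanSpace ℝ (Fin 3)) : (blochMap x).IsHermitian := by
  ext i j
  fin_cases i <;> fin_cases j <;> simp [blochMap_apply, ← sub_eq_add_neg, mul_sub]

theorem Matrix.IsHermitian.exists_blochMap_eq {A : Matrix (Fin 2) (Fin 2) ℂ} (hA : A.IsHermitian)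
    (ht : A.trace = 1) : ∃ x, blochMap x = A := by
  have h01 := hA.apply 0 1
  have h0 := hA.coe_re_apply_self 0
  have h1 := hA.coe_re_apply_self 1
  rw [trace_fin_two] at ht
  have ht' := congrArg Complex.re ht
  have i0 := congrArg Complex.im h0
  have i1 := congrArg Complex.im h1
  have r10 := congrArg Complex.re h01
  have i10 := congrArg Complex.im h01
  simp at ht' i0 i1 r10 i10
  refine ⟨!₂[2 * (A 1 0).re, 2 * (A 1 0).im, 2 * (A 0 0).re - 1], ?_⟩
  ext i j
  fin_cases i <;> fin_cases j <;> apply Complex.ext <;> simp [blochMap_apply] <;> linarith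

theorem Matrix.IsHermitian.posSemidef_of_trace_of_det {A : Matrix (Fin 2) (Fin 2) ℂ}
    (hA : A.IsHermitian) (ht : 0 ≤ A.trace) (hd : 0 ≤ A.det) : A.PosSemidef := by
  rw [hA.trace_eq_sum_eigenvalues, Fin.sum_univ_two] at ht
  rw [hA.det_eq_prod_eigenvalues, Fin.prod_univ_two] at hd
  have ht' : 0 ≤ hA.eigenvalues 0 + hA.eigenvalues 1 := by
    exact Complex.zero_le_real.mp (by push_cast; exact ht)
  have hd' : 0 ≤ hA.eigenvalues 0 * hA.eigenvalues 1 := by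
    exact Complex.zero_le_real.mp (by push_cast; exact hd)
  rw [hA.posSemidef_iff_eigenvalues_nonneg, Pi.le_def, Fin.forall_fin_two]
  simp only [Pi.zero_apply]
  constructor <;> by_contra! h <;> nlinarith

theorem blochMap_image_closedBall : blochMap '' Metric.closedBall 0 1 = stateSpace 2 := by
  have hdet : ∀ x, 0 ≤ (blochMap x).det ↔ ‖x‖ ≤ 1 := fun x => by
    rw [det_blochMap, Complex.zero_le_real, ← sq_le_one_iff₀ (norm_nonneg x)]
    constructor <;> intro h <;> linarith
  ext A
  constructor
  · rintro ⟨x, hx, rfl⟩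
    rw [mem_closedBall_zero_iff] at hx
    exact ⟨(isHermitian_blochMap x).posSemidef_of_trace_of_det
      (by rw [trace_blochMap]; exact zero_le_one) ((hdet x).mpr hx), trace_blochMap x⟩
  · intro hA
    obtain ⟨x, rfl⟩ := hA.1.1.exists_blochMap_eq hA.2
    exact ⟨x, mem_closedBall_zero_iff.mpr ((hdet x).mp hA.1.det_nonneg), rfl⟩

/-- An affine map sends interior points of a set to relative interior points of its image. -/
theorem AffineMap.mem_intrinsicInterior_image {E E' : Type*} [NormedAddCommGroup E]
    [NormedSpace ℝ E] [NormedAddCommGroup E'] [NormedSpace ℝ E'] [FiniteDimensional ℝ E']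
    (T : E →ᵃ[ℝ] E') {s : Set E} {z : E} (hz : z ∈ interior s) :
    T z ∈ intrinsicInterior ℝ (T '' s) := by
  obtain ⟨g, hg⟩ := LinearMap.exists_rightInverse_of_surjective T.linear.rangeRestrict
    T.linear.range_rangeRestrict
  obtain ⟨g', hg'⟩ := LinearMap.exists_extend g
  have hgT : ∀ v, T.linear (g' (T.linear v)) = T.linear v := fun v => by
    have h1 : g' (T.linear v) = g (T.linear.rangeRestrict v) := by rw [← hg']; rfl
    rw [h1]
    exact congrArg Subtype.val (LinearMap.congr_fun hg (T.linear.rangeRestrict v))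
  have hspan : ∀ p ∈ affineSpan ℝ (T '' s), ∃ q, T q = p := by
    have : affineSpan ℝ (T '' s) ≤ (⊤ : AffineSubspace ℝ E).map T := by
      rw [← AffineSubspace.map_span]
      exact AffineSubspace.map_mono T le_top
    intro p hp
    obtain ⟨q, -, hq⟩ := this hp
    exact ⟨q, hq⟩
  have hzs : T z ∈ affineSpan ℝ (T '' s) :=
    subset_affineSpan ℝ _ ⟨z, interior_subset hz, rfl⟩
  refine mem_intrinsicInterior.mpr ⟨⟨T z, hzs⟩, ?_, rfl⟩
  rw [mem_interior_iff_mem_nhds]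
  have hcont : Continuous fun p : affineSpan ℝ (T '' s) => z + g' ((p : E') - T z) :=
    continuous_const.add (g'.continuous_of_finiteDimensional.comp
      (continuous_subtype_val.sub continuous_const))
  have hmem : ∀ᶠ p : affineSpan ℝ (T '' s) in 𝓝 ⟨T z, hzs⟩, z + g' ((p : E') - T z) ∈ s := by
    refine hcont.continuousAt.eventually_mem ?_
    simpa using mem_interior_iff_mem_nhds.mp hz
  filter_upwards [hmem] with p hp
  refine ⟨_, hp, ?_⟩
  obtain ⟨q, hq⟩ := hspan p p.2
  have h1 : (p : E') - T z = T.linear (q - z) := by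
    rw [← hq]; exact (T.linearMap_vsub q z).symm
  have h2 : T (z + g' ((p : E') - T z)) = T.linear (g' ((p : E') - T z)) + T z := by
    rw [add_comm]; exact T.map_vadd z _
  rw [h2, h1, hgT, ← h1, sub_add_cancel]

/-- A relative boundary point of an affine image of the unit ball has a unique preimage
in the ball. -/
theorem AffineMap.existsUnique_mem_closedBall {E E' : Type*} [NormedAddCommGroup E]
    [InnerProductSpace ℝ E] [FiniteDimensional ℝ E] [NormedAddCommGroup E'] [NormedSpace ℝ E']
    [FiniteDimensional ℝ E'] (T : E →ᵃ[ℝ] E') {w : E'}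
    (hw : w ∈ closure (T '' Metric.closedBall 0 1) \
      intrinsicInterior ℝ (T '' Metric.closedBall 0 1)) :
    ∃! x, x ∈ Metric.closedBall (0 : E) 1 ∧ T x = w := by
  have hcomp : IsCompact (T '' Metric.closedBall 0 1) :=
    (isCompact_closedBall 0 1).image T.continuous_of_finiteDimensional
  rw [hcomp.isClosed.closure_eq] at hw
  obtain ⟨⟨x, hx, hxw⟩, hni⟩ := hw
  refine ⟨x, ⟨hx, hxw⟩, ?_⟩
  rintro y ⟨hy, hyw⟩
  by_contra hne
  refine hni ?_
  have hmid : (2⁻¹ : ℝ) • y + (2⁻¹ : ℝ) • x ∈ interior (Metric.closedBall (0 : E) 1) :=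
    strictConvex_closedBall ℝ (0 : E) 1 hy hx hne (by norm_num) (by norm_num) (by norm_num)
  have hTw : T ((2⁻¹ : ℝ) • y + (2⁻¹ : ℝ) • x) = w := by
    rw [Convex.combo_affine_apply (by norm_num), hxw, hyw, ← add_smul]
    norm_num
  rw [← hTw]
  exact T.mem_intrinsicInterior_image hmid

theorem AffineMap.convDim_image_le {E E' : Type*} [NormedAddCommGroup E] [NormedSpace ℝ E]
    [FiniteDimensional ℝ E] [NormedAddCommGroup E'] [NormedSpace ℝ E'] (T : E →ᵃ[ℝ] E')
    (s : Set E) : convDim (T '' s) ≤ Module.finrank ℝ E := by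
  rw [convDim, ← AffineSubspace.map_span, AffineSubspace.map_direction]
  exact (Submodule.finrank_map_le _ _).trans (Submodule.finrank_le _)

theorem nontrivial_of_convDim_pos {E : Type*} [NormedAddCommGroup E] [NormedSpace ℝ E]
    {s : Set E} (h : 0 < convDim s) : s.Nontrivial := by
  by_contra hs
  rw [not_nontrivial_iff] at hs
  rw [convDim, direction_affineSpan, vectorSpan_of_subsingleton ℝ hs, finrank_bot] at h
  exact lt_irrefl _ h

/-- The expected value map as a real linear map. -/
noncomputable def expValₗ {d r : ℕ} (u : Fin r → Matrix (Fin d) (Fin d) ℂ) :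
    Matrix (Fin d) (Fin d) ℂ →ₗ[ℝ] (Fin r → ℝ) where
  toFun := expVal u
  map_add' A B := by ext i; simp [expVal, mul_add]
  map_smul' c A := by ext i; simp [expVal]

theorem convex_stateSpace (d : ℕ) : Convex ℝ (stateSpace d) := by
  rintro A hA B hB a b ha hb hab
  refine ⟨(hA.1.smul ha).add (hB.1.smul hb), ?_⟩
  rw [trace_add, trace_smul, trace_smul, hA.2, hB.2, ← add_smul, hab, one_smul]

theorem proper_face_is_affine_image_of_ball {r : ℕ}
    (u : Fin r → Matrix (Fin 3) (Fin 3) ℂ) (hu : ∀ i, (u i).IsHermitian)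
    (F : Set (Fin r → ℝ)) (hF : IsFaceOf (expVal u '' stateSpace 3) F)
    (hdim0 : 0 < convDim F)
    (hdimL : convDim F < convDim (expVal u '' stateSpace 3)) :
    (∃ T : EuclideanSpace ℝ (Fin 3) →ᵃ[ℝ] (Fin r → ℝ), T '' Metric.closedBall 0 1 = F) ∧
    convDim F ∈ ({1, 2, 3} : Set ℕ) ∧
    (∀ w ∈ closure F \ intrinsicInterior ℝ F,
      ∃! ρ : Matrix (Fin 3) (Fin 3) ℂ, ρ ∈ stateSpace 3 ∧ expVal u ρ = w) := by
  have hFL := hF.2.subset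
  set G : Set (Matrix (Fin 3) (Fin 3) ℂ) := stateSpace 3 ∩ expValₗ u ⁻¹' F
  have hEG : expVal u '' G = F := by
    ext w
    constructor
    · rintro ⟨ρ, hρ, rfl⟩
      exact hρ.2
    · intro hw
      obtain ⟨ρ, hρ, rfl⟩ := hFL hw
      exact ⟨ρ, ⟨hρ, hw⟩, rfl⟩
  have hGconv : Convex ℝ G := (convex_stateSpace 3).inter (hF.1.linear_preimage (expValₗ u))
  have hGext : IsExtreme ℝ (stateSpace 3) G := by
    refine ⟨inter_subset_left, fun x hx y hy z hz hzxy => ⟨hx, ?_⟩⟩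
    refine hF.2.left_mem_of_mem_openSegment (mem_image_of_mem _ hx) (mem_image_of_mem _ hy) hz.2 ?_
    have := mem_image_of_mem (expValₗ u).toAffineMap hzxy
    rwa [image_openSegment] at this
  have hGne : G ≠ stateSpace 3 := fun h => by
    rw [← hEG, h] at hdimL
    exact lt_irrefl _ hdimL
  have hGnt : G.Nontrivial := by
    have := nontrivial_of_convDim_pos hdim0
    rw [← hEG] at this
    exact nontrivial_of_image _ _ this
  obtain ⟨V, hV⟩ := exists_eq_conj_image_of_isExtreme_stateSpace hGconv hGext hGne hGnt
  let c : Matrix (Fin 2) (Fin 2) ℂ →ₗ[ℝ] Matrix (Fin 3) (Fin 3) ℂ :=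
    { toFun := fun B => V * B * Vᴴ
      map_add' := fun A B => by rw [Matrix.mul_add, Matrix.add_mul]
      map_smul' := fun a A => by simp }
  let A : EuclideanSpace ℝ (Fin 3) →ᵃ[ℝ] Matrix (Fin 3) (Fin 3) ℂ := c.toAffineMap.comp blochMap
  have hAG : A '' Metric.closedBall 0 1 = G := by
    rw [hV, ← blochMap_image_closedBall, image_image]
    rfl
  let T : EuclideanSpace ℝ (Fin 3) →ᵃ[ℝ] (Fin r → ℝ) := (expValₗ u).toAffineMap.comp A
  have hTF : T '' Metric.closedBall 0 1 = F := by
    rw [← hEG, ← hAG, image_image]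
    rfl
  refine ⟨⟨T, hTF⟩, ?_, fun w hw => ?_⟩
  · have h3 : convDim F ≤ 3 := by
      rw [← hTF]
      simpa using T.convDim_image_le (Metric.closedBall 0 1)
    simp only [mem_insert_iff, mem_singleton_iff]
    omega
  · rw [← hTF] at hw
    obtain ⟨x, ⟨hx, hxw⟩, huniq⟩ := T.existsUnique_mem_closedBall hw
    have hxG : A x ∈ G := hAG ▸ mem_image_of_mem A hx
    refine ⟨A x, ⟨hxG.1, hxw⟩, ?_⟩
    rintro ρ ⟨hρ, hρw⟩
    have hρG : ρ ∈ G := ⟨hρ, by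
      have h : T x ∈ F := hTF ▸ mem_image_of_mem T hx
      rw [hxw, ← hρw] at h
      exact h⟩
    rw [← hAG] at hρG
    obtain ⟨y, hy, rfl⟩ := hρG
    rw [huniq y ⟨hy, hρw⟩]
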